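/- arXiv:1610.05915 — 2 statements merged into one kernel-verified Lean document; each statement's English description precedes it below -/
import Mathlib

section
/- Let X be a real Banach space, φ₁ : X × X × [0,1] → X and φ₂ : X × X × [0,1] × (X → ℝ) → ℝ. Assume (P₁): φ₁(x, x, 0) = x for all x ∈ X; (P₃): there is C ≥ 1 with φ₂(λx, λx, 0, h) ≤ C((1 − λ)h(0) + λh(x)) for all x ∈ X, λ ∈ [0,1], h ∈ Φ; and assume that Φ is closed in the Banach space (M, μ). Then F = {f ∈ Φ : f(x) → +∞ as ‖x‖ → +∞}, with the metric ρ(f,g) = μ(f − g), is a Baire space (every countable intersection of dense open subsets of F is dense in F). -/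
open Filter Set ENNReal

/-- `‖f‖_r = sup {|f x| : ‖x‖ ≤ r}`, valued in `ℝ≥0∞`. -/
noncomputable def ballSup {X : Type*} [NormedAddCommGroup X] (f : X → ℝ) (r : ℝ) : ℝ≥0∞ :=
  ⨆ x ∈ {x : X | ‖x‖ ≤ r}, (‖f x‖₊ : ℝ≥0∞)

/-- `μ(f) = Σ_{n ≥ 1} ‖f‖ₙ / 2ⁿ`, valued in `ℝ≥0∞`. -/
noncomputable def mu {X : Type*} [NormedAddCommGroup X] (f : X → ℝ) : ℝ≥0∞ :=
  ∑' n : ℕ, ballSup f (n + 1) / 2 ^ (n + 1)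

/-- A function `f : X → ℝ` is `(φ₁, φ₂)`-convex if
`f (φ₁ x y λ) ≤ φ₂ x y λ f` for all `x, y ∈ X` and `λ ∈ [0,1]`. -/
def PhiConvex {X : Type*} [NormedAddCommGroup X] [NormedSpace ℝ X]
    (φ₁ : X → X → ℝ → X) (φ₂ : X → X → ℝ → (X → ℝ) → ℝ) (f : X → ℝ) : Prop :=
  ∀ x y : X, ∀ t ∈ Set.Icc (0 : ℝ) 1, f (φ₁ x y t) ≤ φ₂ x y t f

section MuLemmas

variable {X : Type*} [NormedAddCommGroup X]

lemma enorm_le_ballSup (f : X → ℝ) {x : X} {r : ℝ} (hx : ‖x‖ ≤ r) : ‖f x‖ₑ ≤ ballSup f r :=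
  le_iSup₂_of_le x hx le_rfl

lemma ballSup_le {f : X → ℝ} {r : ℝ} {a : ℝ≥0∞} (h : ∀ x, ‖x‖ ≤ r → ‖f x‖ₑ ≤ a) :
    ballSup f r ≤ a :=
  iSup₂_le h

lemma ballSup_add_le (f g : X → ℝ) (r : ℝ) : ballSup (f + g) r ≤ ballSup f r + ballSup g r :=
  ballSup_le fun _ hx =>
    (enorm_add_le _ _).trans (add_le_add (enorm_le_ballSup f hx) (enorm_le_ballSup g hx))

lemma mu_zero : mu (0 : X → ℝ) = 0 := by
  have h (r : ℝ) : ballSup (0 : X → ℝ) r = 0 := le_antisymm (ballSup_le (by simp)) bot_le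
  simp [mu, h]

lemma mu_sub_comm (f g : X → ℝ) : mu (f - g) = mu (g - f) := by
  have h (x : X) : ‖(f - g) x‖₊ = ‖(g - f) x‖₊ := by
    simpa [NNReal.eq_iff] using abs_sub_comm (f x) (g x)
  simp only [mu, ballSup, h]

lemma mu_add_le (f g : X → ℝ) : mu (f + g) ≤ mu f + mu g := by
  rw [mu, mu, mu, ← ENNReal.tsum_add]
  refine ENNReal.tsum_le_tsum fun n => ?_
  rw [← ENNReal.add_div]
  exact ENNReal.div_le_div_right (ballSup_add_le _ _ _) _

lemma mu_sub_le (f g h : X → ℝ) : mu (f - h) ≤ mu (f - g) + mu (g - h) := by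
  simpa using mu_add_le (f - g) (g - h)

lemma enorm_le_mul_mu (f : X → ℝ) {x : X} {n : ℕ} (hx : ‖x‖ ≤ n + 1) :
    ‖f x‖ₑ ≤ mu f * 2 ^ (n + 1) := by
  have h : ballSup f (n + 1) / 2 ^ (n + 1) ≤ mu f :=
    ENNReal.le_tsum (f := fun n : ℕ => ballSup f (n + 1) / 2 ^ (n + 1)) n
  exact (enorm_le_ballSup f hx).trans ((ENNReal.div_le_iff (by simp) (by simp)).1 h)

lemma lowerSemicontinuous_mu : LowerSemicontinuous (mu : (X → ℝ) → ℝ≥0∞) := by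
  refine lowerSemicontinuous_tsum fun n => ?_
  simp only [ballSup, ENNReal.div_eq_inv_mul, ENNReal.mul_iSup]
  refine lowerSemicontinuous_iSup fun x => lowerSemicontinuous_iSup fun _ => ?_
  refine Continuous.lowerSemicontinuous ?_
  refine (ENNReal.continuous_const_mul (by simp)).comp ?_
  exact (continuous_apply x).enorm

lemma abs_lt_one_of_mu_lt {f : X → ℝ} {n : ℕ} (hf : mu f < ENNReal.ofReal ((2 ^ (n + 1))⁻¹))
    {x : X} (hx : ‖x‖ ≤ n + 1) : |f x| < 1 := by
  have h : ‖f x‖ₑ < 1 := by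
    refine (enorm_le_mul_mu f hx).trans_lt ?_
    rw [ENNReal.ofReal_inv_of_pos (by positivity), ENNReal.ofReal_pow (by norm_num),
      ENNReal.ofReal_ofNat] at hf
    exact (ENNReal.mul_lt_mul_left (by simp) (by simp) hf).trans_eq
      (ENNReal.inv_mul_cancel (by simp) (by simp))
  rwa [← ofReal_norm, ENNReal.ofReal_lt_one] at h

/-- A set of functions on `X`, equipped with the distance `μ (f - g)`. -/
def MuSpace (S : Set (X → ℝ)) : Type _ := S

noncomputable instance (S : Set (X → ℝ)) : PseudoEMetricSpace (MuSpace S) where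
  edist f g := mu (f.1 - g.1)
  edist_self f := by simp [mu_zero]
  edist_comm f g := mu_sub_comm _ _
  edist_triangle f g h := mu_sub_le _ _ _

lemma MuSpace.edist_def {S : Set (X → ℝ)} (f g : MuSpace S) : edist f g = mu (f.1 - g.1) := rfl

/-- A sequence of continuous functions that is Cauchy for `μ` has a continuous limit. -/
lemma exists_continuous_tendsto_mu {u : ℕ → X → ℝ} (hu : ∀ n, Continuous (u n))
    (hc : ∀ ε : ℝ≥0∞, 0 < ε → ∃ N, ∀ m ≥ N, ∀ n ≥ N, mu (u m - u n) < ε) :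
    ∃ f : X → ℝ, Continuous f ∧ Tendsto (fun n => mu (u n - f)) atTop (nhds 0) := by
  have hball (k : ℕ) (ε : ℝ≥0∞) (hε : 0 < ε) :
      ∃ δ : ℝ≥0∞, 0 < δ ∧ δ * 2 ^ (k + 1) ≤ ε :=
    ⟨ε / 2 ^ (k + 1), ENNReal.div_pos hε.ne' (by simp),
      (ENNReal.div_mul_cancel (by simp) (by simp)).le⟩
  have hpt (x : X) : CauchySeq fun n => u n x := by
    obtain ⟨k, hk⟩ := exists_nat_ge ‖x‖
    refine EMetric.cauchySeq_iff.2 fun ε hε => ?_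
    obtain ⟨δ, hδ, hδε⟩ := hball k ε hε
    obtain ⟨N, hN⟩ := hc δ hδ
    refine ⟨N, fun m hm n hn => ?_⟩
    rw [edist_eq_enorm_sub]
    exact ((enorm_le_mul_mu (u m - u n) (n := k) (by linarith)).trans_lt
      (ENNReal.mul_lt_mul_left (by simp) (by simp) (hN m hm n hn))).trans_le hδε
  choose f hf using fun x => cauchySeq_tendsto_of_complete (hpt x)
  have hlim : Tendsto u atTop (nhds f) := tendsto_pi_nhds.2 hf
  have hmu : Tendsto (fun n => mu (u n - f)) atTop (nhds 0) := by
    refine ENNReal.tendsto_nhds_zero.2 fun ε hε => ?_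
    obtain ⟨N, hN⟩ := hc ε hε
    filter_upwards [eventually_ge_atTop N] with n hn
    refine (lowerSemicontinuous_mu.isClosed_preimage ε).mem_of_tendsto
      (tendsto_const_nhds.sub hlim) ?_
    filter_upwards [eventually_ge_atTop N] with m hm
    exact (hN n hn m hm).le
  refine ⟨f, ?_, hmu⟩
  have hloc : TendstoLocallyUniformly u f atTop := by
    refine EMetric.tendstoLocallyUniformly_iff.2 fun ε hε x => ?_
    obtain ⟨k, hk⟩ := exists_nat_ge ‖x‖
    obtain ⟨δ, hδ, hδε⟩ := hball k ε hε
    refine ⟨Metric.ball x 1, Metric.ball_mem_nhds x one_pos, ?_⟩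
    filter_upwards [hmu.eventually_lt_const hδ] with n hn y hy
    have hy' : ‖y‖ ≤ k + 1 := by
      have := norm_sub_norm_le y x
      rw [mem_ball_iff_norm] at hy
      linarith
    rw [edist_comm, edist_eq_enorm_sub]
    exact ((enorm_le_mul_mu (u n - f) hy').trans_lt
      (ENNReal.mul_lt_mul_left (by simp) (by simp) hn)).trans_le hδε
  exact hloc.continuous (Eventually.of_forall hu).frequently

lemma MuSpace.completeSpace {S : Set (X → ℝ)} (hcont : ∀ f ∈ S, Continuous f)
    (hfin : ∀ f ∈ S, mu f < ⊤)
    (hclosed : ∀ f : X → ℝ, Continuous f → mu f < ⊤ →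
      (∀ ε : ℝ, 0 < ε → ∃ g ∈ S, mu (f - g) < ENNReal.ofReal ε) → f ∈ S) :
    CompleteSpace (MuSpace S) := by
  refine EMetric.complete_of_cauchySeq_tendsto fun u hu => ?_
  obtain ⟨f, hf, hlim⟩ := exists_continuous_tendsto_mu (fun n => hcont _ (u n).2)
    (fun ε hε => EMetric.cauchySeq_iff.1 hu ε hε)
  have happrox (ε : ℝ≥0∞) (hε : 0 < ε) : ∃ g ∈ S, mu (f - g) < ε := by
    obtain ⟨n, hn⟩ := (hlim.eventually_lt_const hε).exists
    exact ⟨_, (u n).2, by rwa [mu_sub_comm]⟩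
  have hfS : f ∈ S := by
    refine hclosed f hf ?_ fun ε hε => happrox _ (ENNReal.ofReal_pos.2 hε)
    obtain ⟨g, hg, hfg⟩ := happrox 1 one_pos
    have := mu_add_le (f - g) g
    rw [sub_add_cancel] at this
    exact this.trans_lt (ENNReal.add_lt_top.2 ⟨hfg.trans ENNReal.one_lt_top, hfin g hg⟩)
  exact ⟨⟨f, hfS⟩, tendsto_iff_edist_tendsto_0.2 hlim⟩

/-- A function with `h (t x) ≤ C ((1 - t) h 0 + t h x)` which exceeds `C h 0 + 1` on a sphere
centered at the origin is coercive. -/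
lemma tendsto_atTop_of_le_on_sphere [NormedSpace ℝ X] {h : X → ℝ} {C R : ℝ} (hC : 0 < C)
    (hR : 0 < R) (h0 : 0 ≤ h 0)
    (hconv : ∀ x, ∀ t ∈ Set.Icc (0 : ℝ) 1, h (t • x) ≤ C * ((1 - t) * h 0 + t * h x))
    (hsphere : ∀ x, ‖x‖ = R → C * h 0 + 1 ≤ h x) :
    Tendsto h (comap (fun x : X => ‖x‖) atTop) atTop := by
  have hlin : Tendsto (fun x : X => ‖x‖ / (C * R)) (comap (fun x : X => ‖x‖) atTop) atTop :=
    tendsto_comap.atTop_div_const (by positivity)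
  refine tendsto_atTop_mono' _ ?_ hlin
  filter_upwards [tendsto_comap.eventually (eventually_ge_atTop R)] with y hy
  have hy0 : 0 < ‖y‖ := hR.trans_le hy
  set t := R / ‖y‖ with ht
  have ht0 : 0 < t := div_pos hR hy0
  have hnorm : ‖t • y‖ = R := by
    rw [norm_smul, Real.norm_of_nonneg ht0.le, ht, div_mul_cancel₀ _ hy0.ne']
  have key := (hsphere _ hnorm).trans (hconv y t ⟨ht0.le, (div_le_one hy0).2 hy⟩)
  have hCt : 1 ≤ C * t * h y := by nlinarith [mul_nonneg (mul_pos hC ht0).le h0]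
  rw [div_le_iff₀ (by positivity)]
  have : C * t * h y = h y * (C * R) / ‖y‖ := by rw [ht]; ring
  rw [this, le_div_iff₀ hy0] at hCt
  linarith

end MuLemmas

/-- Countably many open sets, each dense in an open subset `F` of a Baire space, have an
intersection that is dense in `F`. -/
lemma subset_closure_iInter_inter_of_isOpen {α : Type*} [TopologicalSpace α] [BaireSpace α]
    {F : Set α} (hF : IsOpen F) {V : ℕ → Set α} (hV : ∀ n, IsOpen (V n))
    (hd : ∀ n, F ⊆ closure (V n ∩ F)) : F ⊆ closure ((⋂ n, V n) ∩ F) := by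
  have hdense : Dense (⋂ n, (V n ∪ (closure F)ᶜ)) := by
    refine dense_iInter_of_isOpen (fun n => (hV n).union isClosed_closure.isOpen_compl)
      fun n x => ?_
    by_cases hx : x ∈ closure F
    · exact closure_mono (inter_subset_left.trans subset_union_left)
        (closure_minimal (hd n) isClosed_closure hx)
    · exact subset_closure (Or.inr hx)
  refine (hdense.open_subset_closure_inter hF).trans (closure_mono ?_)
  rintro x ⟨hxF, hx⟩
  refine ⟨Set.mem_iInter.2 fun n => ?_, hxF⟩
  exact (Set.mem_iInter.1 hx n).resolve_right fun h => h (subset_closure hxF)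

/-- Under (P₁), (P₃), and the closedness of `Φ` in `(M, μ)`, the metric space
`(F, ρ)` with `ρ(f,g) = μ(f-g)` is a Baire space: every countable intersection of dense
open subsets of `F` is dense in `F`. -/
theorem F_is_BaireSpace
    {X : Type*} [NormedAddCommGroup X] [NormedSpace ℝ X] [CompleteSpace X]
    (φ₁ : X → X → ℝ → X) (φ₂ : X → X → ℝ → (X → ℝ) → ℝ)
    (Phi Fs : Set (X → ℝ))
    (hPhi : Phi = {f : X → ℝ | Continuous f ∧ mu f < ⊤ ∧ PhiConvex φ₁ φ₂ f ∧ ∀ x, 0 ≤ f x})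
    (hFs : Fs = {f ∈ Phi | Tendsto f (comap (fun x : X => ‖x‖) atTop) atTop})
    (hP1 : ∀ x : X, φ₁ x x 0 = x)
    (hP3 : ∃ C : ℝ, 1 ≤ C ∧ ∀ h ∈ Phi, ∀ x : X, ∀ t ∈ Set.Icc (0 : ℝ) 1,
      φ₂ (t • x) (t • x) 0 h ≤ C * ((1 - t) * h 0 + t * h x))
    (hclosed : ∀ f : X → ℝ, Continuous f → mu f < ⊤ →
      (∀ ε : ℝ, 0 < ε → ∃ g ∈ Phi, mu (f - g) < ENNReal.ofReal ε) → f ∈ Phi) :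
    ∀ U : ℕ → Set (X → ℝ),
      -- each `U n` is open in `F`
      (∀ n : ℕ, ∀ f ∈ U n ∩ Fs, ∃ ε : ℝ, 0 < ε ∧
        ∀ g ∈ Fs, mu (f - g) < ENNReal.ofReal ε → g ∈ U n) →
      -- each `U n` is dense in `F`
      (∀ n : ℕ, ∀ f ∈ Fs, ∀ ε : ℝ, 0 < ε → ∃ g ∈ U n ∩ Fs, mu (f - g) < ENNReal.ofReal ε) →
      -- then `⋂ n, U n` is dense in `F`
      ∀ f ∈ Fs, ∀ ε : ℝ, 0 < ε → ∃ g ∈ (⋂ n, U n) ∩ Fs, mu (f - g) < ENNReal.ofReal ε := by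
  intro U hopen hdense f hf ε hε
  obtain ⟨C, hC, hP3⟩ := hP3
  have hsub : Fs ⊆ Phi := by rw [hFs]; exact sep_subset _ _
  have hconv : ∀ h ∈ Phi, ∀ x : X, ∀ t ∈ Set.Icc (0 : ℝ) 1,
      h (t • x) ≤ C * ((1 - t) * h 0 + t * h x) := by
    intro h hh x t ht
    refine le_trans ?_ (hP3 h hh x t ht)
    rw [hPhi] at hh
    simpa [hP1] using hh.2.2.1 (t • x) (t • x) 0 (by simp)
  have hFopen : ∀ f ∈ Fs, ∃ ε : ℝ, 0 < ε ∧ ∀ g ∈ Phi, mu (f - g) < ENNReal.ofReal ε → g ∈ Fs := by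
    intro f hf
    have hlim : Tendsto f (comap (fun x : X => ‖x‖) atTop) atTop := by rw [hFs] at hf; exact hf.2
    obtain ⟨R, hR⟩ := eventually_atTop.1
      (eventually_comap.1 (hlim.eventually (eventually_ge_atTop (C * (f 0 + 1) + 2))))
    obtain ⟨n, hn⟩ := exists_nat_ge R
    refine ⟨(2 ^ (n + 1))⁻¹, by positivity, fun g hg hfg => ?_⟩
    have h0 := abs_lt.1 (abs_lt_one_of_mu_lt hfg (x := 0) (by simp; positivity))
    have hg0 : 0 ≤ g 0 := by rw [hPhi] at hg; exact hg.2.2.2 0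
    rw [hFs]
    refine ⟨hg, tendsto_atTop_of_le_on_sphere (C := C) (R := n + 1) (by linarith) (by positivity)
      hg0 (hconv g hg) fun x hx => ?_⟩
    have hfx := hR (n + 1) (by linarith) x hx
    have hx := abs_lt.1 (abs_lt_one_of_mu_lt hfg hx.le)
    simp only [Pi.sub_apply] at h0 hx
    nlinarith
  have : CompleteSpace (MuSpace Phi) :=
    MuSpace.completeSpace (by rw [hPhi]; exact fun f hf => hf.1)
      (by rw [hPhi]; exact fun f hf => hf.2.1) hclosed
  have hisOpen (A : Set (X → ℝ)) (hA : ∀ f ∈ A, ∃ ε : ℝ, 0 < ε ∧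
      ∀ g ∈ Phi, mu (f - g) < ENNReal.ofReal ε → g ∈ A) :
      IsOpen {f : MuSpace Phi | f.1 ∈ A} := by
    refine EMetric.isOpen_iff.2 fun f hf => ?_
    obtain ⟨ε, hε, h⟩ := hA f.1 hf
    refine ⟨ENNReal.ofReal ε, ENNReal.ofReal_pos.2 hε, fun g hg => h g.1 g.2 ?_⟩
    rwa [mu_sub_comm]
  have hbaire := subset_closure_iInter_inter_of_isOpen (α := MuSpace Phi) (F := {f | f.1 ∈ Fs})
    (V := fun n => {f | f.1 ∈ U n ∩ Fs}) (hisOpen Fs hFopen) (fun n => hisOpen _ ?_) ?_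
  · obtain ⟨g, hg, hfg⟩ := EMetric.mem_closure_iff.1
      (hbaire (show (⟨f, hsub hf⟩ : MuSpace Phi) ∈ {f : MuSpace Phi | f.1 ∈ Fs} from hf))
      (ENNReal.ofReal ε) (ENNReal.ofReal_pos.2 hε)
    exact ⟨g.1, ⟨Set.mem_iInter.2 fun n => (Set.mem_iInter.1 hg.1 n).1, hg.2⟩, hfg⟩
  · rintro f hf
    obtain ⟨ε₁, hε₁, h₁⟩ := hFopen f hf.2
    obtain ⟨ε₂, hε₂, h₂⟩ := hopen n f hf
    refine ⟨min ε₁ ε₂, lt_min hε₁ hε₂, fun g hg hfg => ?_⟩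
    have hgF := h₁ g hg (hfg.trans_le (ENNReal.ofReal_le_ofReal (min_le_left _ _)))
    exact ⟨h₂ g hgF (hfg.trans_le (ENNReal.ofReal_le_ofReal (min_le_right _ _))), hgF⟩
  · refine fun n f hf => EMetric.mem_closure_iff.2 fun ε hε => ?_
    obtain ⟨δ, -, hδ, hδε⟩ := ENNReal.lt_iff_exists_real_btwn.1 hε
    obtain ⟨g, hg, hfg⟩ := hdense n f.1 hf δ (ENNReal.ofReal_pos.1 hδ)
    exact ⟨⟨g, hsub hg.2⟩, ⟨hg, hg.2⟩, hfg.trans hδε⟩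
end

section
/- Let X be a real Banach space and φ₁, φ₂ satisfy (P₁) φ₁(x,x,0) = x and (P₃) there is C ≥ 1 with φ₂(λx, λx, 0, h) ≤ C((1−λ)h(0) + λh(x)) for all x ∈ X, λ ∈ [0,1], h ∈ Φ. Let f : X → ℝ ∪ {+∞} be proper, lower semicontinuous and bounded below, and let Y ⊆ F carry a metric ρ_Y with ρ_Y(g,h) ≥ μ(g − h) for all g, h ∈ Y. Then for every positive integer n, the set Gₙ = {g ∈ Y : there exists x₀ ∈ X with (f+g)(x₀) < inf{(f+g)(x) : ‖x − x₀‖ ≥ 1/n}} is open in (Y, ρ_Y). -/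
open Filter Set ENNReal

theorem abs_le_of_mu_le {X : Type*} [NormedAddCommGroup X] {u : X → ℝ} {r : ℝ} (hr : 0 ≤ r)
    (hu : mu u ≤ ENNReal.ofReal r) (N : ℕ) {x : X} (hx : ‖x‖ ≤ (N : ℝ) + 1) :
    |u x| ≤ 2 ^ (N + 1) * r := by
  have hle : (‖u x‖₊ : ℝ≥0∞) ≤ ballSup u (N + 1) :=
    le_iSup₂ (f := fun (y : X) (_ : y ∈ {y : X | ‖y‖ ≤ (N : ℝ) + 1}) => (‖u y‖₊ : ℝ≥0∞)) x hx
  have hterm : ballSup u (N + 1) / 2 ^ (N + 1) ≤ ENNReal.ofReal r :=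
    (ENNReal.le_tsum N).trans hu
  have hpow : ballSup u (N + 1) ≤ ENNReal.ofReal r * 2 ^ (N + 1) :=
    (ENNReal.div_le_iff (by positivity) (ENNReal.pow_ne_top (by simp))).1 hterm
  have hreal := ENNReal.toReal_mono
    (ENNReal.mul_ne_top ENNReal.ofReal_ne_top (ENNReal.pow_ne_top (by simp))) (hle.trans hpow)
  simpa [ENNReal.toReal_ofReal hr, mul_comm] using hreal

/-- If `h (t • x) ≤ C * ((1 - t) * h 0 + t * h x)` along rays and `h` is large on the sphere of
radius `R`, then `h` is large outside the ball of radius `R`. -/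
theorem le_of_forall_sphere_le {X : Type*} [NormedAddCommGroup X] [NormedSpace ℝ X]
    {h : X → ℝ} {C K R : ℝ} (hC : 0 < C) (hR : 0 < R)
    (hray : ∀ x : X, ∀ t ∈ Set.Icc (0 : ℝ) 1, h (t • x) ≤ C * ((1 - t) * h 0 + t * h x))
    (h0 : h 0 ≤ K) (hsphere : ∀ y : X, ‖y‖ = R → C * K ≤ h y) {x : X} (hx : R ≤ ‖x‖) :
    K ≤ h x := by
  have hxpos : 0 < ‖x‖ := hR.trans_le hx
  have htpos : 0 < R / ‖x‖ := div_pos hR hxpos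
  have htle : R / ‖x‖ ≤ 1 := (div_le_one hxpos).2 hx
  have hnorm : ‖(R / ‖x‖) • x‖ = R := by
    rw [norm_smul, Real.norm_of_nonneg htpos.le, div_mul_cancel₀ _ hxpos.ne']
  have hK := le_of_mul_le_mul_left
    ((hsphere _ hnorm).trans (hray x _ ⟨htpos.le, htle⟩)) hC
  have hprod := mul_le_mul_of_nonneg_left h0 (sub_nonneg.2 htle)
  exact le_of_mul_le_mul_left (by linarith) htpos

/-- Claim 1 in the proof of Theorem 3.1: each set
`Gₙ = {g ∈ Y : ∃ x₀, (f+g)(x₀) < inf {(f+g)(x) : ‖x - x₀‖ ≥ 1/n}}` is open in `(Y, ρ_Y)`. -/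
theorem Gn_isOpen
    {X : Type*} [NormedAddCommGroup X] [NormedSpace ℝ X] [CompleteSpace X]
    (φ₁ : X → X → ℝ → X) (φ₂ : X → X → ℝ → (X → ℝ) → ℝ)
    (Phi Fs : Set (X → ℝ))
    (hPhi : Phi = {f : X → ℝ | Continuous f ∧ mu f < ⊤ ∧ PhiConvex φ₁ φ₂ f ∧ ∀ x, 0 ≤ f x})
    (hFs : Fs = {f ∈ Phi | Tendsto f (comap (fun x : X => ‖x‖) atTop) atTop})
    (hP1 : ∀ x : X, φ₁ x x 0 = x)
    (hP3 : ∃ C : ℝ, 1 ≤ C ∧ ∀ h ∈ Phi, ∀ x : X, ∀ t ∈ Set.Icc (0 : ℝ) 1,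
      φ₂ (t • x) (t • x) 0 h ≤ C * ((1 - t) * h 0 + t * h x))
    (f : X → EReal)
    (hbot : ∀ x, f x ≠ ⊥) (hproper : ∃ x, f x ≠ ⊤)
    (hlsc : LowerSemicontinuous f) (hbdd : ∃ b : ℝ, ∀ x, (b : EReal) ≤ f x)
    (Y : Set (X → ℝ)) (hYF : Y ⊆ Fs)
    (ρY : (X → ℝ) → (X → ℝ) → ℝ)
    (hρY_nonneg : ∀ g h : X → ℝ, 0 ≤ ρY g h)
    (hρY_eq_zero : ∀ g ∈ Y, ∀ h ∈ Y, (ρY g h = 0 ↔ g = h))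
    (hρY_symm : ∀ g h : X → ℝ, ρY g h = ρY h g)
    (hρY_tri : ∀ g h k : X → ℝ, ρY g k ≤ ρY g h + ρY h k)
    (hρY_ge : ∀ g ∈ Y, ∀ h ∈ Y, mu (g - h) ≤ ENNReal.ofReal (ρY g h)) :
    ∀ n : ℕ, 0 < n →
      ∀ g ∈ {g ∈ Y | ∃ x₀ : X, f x₀ + (g x₀ : EReal) <
        ⨅ x ∈ {x : X | 1 / (n : ℝ) ≤ ‖x - x₀‖}, (f x + (g x : EReal))},
      ∃ ε : ℝ, 0 < ε ∧ ∀ h ∈ Y, ρY g h < ε →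
        h ∈ {g ∈ Y | ∃ x₀ : X, f x₀ + (g x₀ : EReal) <
          ⨅ x ∈ {x : X | 1 / (n : ℝ) ≤ ‖x - x₀‖}, (f x + (g x : EReal))} := by
  obtain ⟨C, hC, hP3⟩ := hP3
  obtain ⟨b, hb⟩ := hbdd
  rintro n - g ⟨hgY, x₀, hx₀⟩
  subst hFs hPhi
  obtain ⟨c₁, hc₁, hc₁'⟩ := EReal.lt_iff_exists_real_btwn.1 hx₀
  obtain ⟨c₂, hc₂, hc₂'⟩ := EReal.lt_iff_exists_real_btwn.1 hc₁'
  have hc : c₁ < c₂ := EReal.coe_lt_coe_iff.1 hc₂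
  set K : ℝ := max (g 0 + 1) (c₂ - b)
  obtain ⟨R, hR⟩ : ∃ R : ℝ, ∀ y : X, R ≤ ‖y‖ → C * K + 1 ≤ g y := by
    have hlarge := (hYF hgY).2.eventually_ge_atTop (C * K + 1)
    rw [eventually_comap, eventually_atTop] at hlarge
    obtain ⟨R, hR⟩ := hlarge
    exact ⟨R, fun y hy => hR _ hy y rfl⟩
  obtain ⟨N, hN⟩ := exists_nat_ge (max R ‖x₀‖)
  have hRN : R ≤ (N : ℝ) := (le_max_left _ _).trans hN
  have hx₀N : ‖x₀‖ ≤ (N : ℝ) := (le_max_right _ _).trans hN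
  have hN0 : (0 : ℝ) ≤ N := N.cast_nonneg
  set δ : ℝ := min 1 ((c₂ - c₁) / 3)
  have hδ : 0 < δ := lt_min one_pos (by linarith)
  have hδ1 : δ ≤ 1 := min_le_left _ _
  have hδc : δ ≤ (c₂ - c₁) / 3 := min_le_right _ _
  refine ⟨δ / 2 ^ (N + 1), by positivity, fun h hhY hgh => ⟨hhY, x₀, ?_⟩⟩
  have hclose : ∀ y : X, ‖y‖ ≤ (N : ℝ) + 1 → |g y - h y| ≤ δ := fun y hy => by
    have hy' := abs_le_of_mu_le (hρY_nonneg g h) (hρY_ge g hgY h hhY) N hy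
    rw [lt_div_iff₀' (by positivity)] at hgh
    exact hy'.trans hgh.le
  have hfar : ∀ y : X, (N : ℝ) + 1 ≤ ‖y‖ → K ≤ h y := fun y hy => by
    refine le_of_forall_sphere_le (C := C) (by linarith) (by linarith) (fun z t ht => ?_) ?_
      (fun z hz => ?_) hy
    · have hconv := (hYF hhY).1.2.2.1 (t • z) (t • z) 0 (by simp)
      rw [hP1] at hconv
      exact hconv.trans (hP3 h (hYF hhY).1 z t ht)
    · have h0 := abs_le.1 (hclose 0 (by simp; linarith))
      exact le_trans (by linarith [h0.1]) (le_max_left _ _)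
    · have hz' := abs_le.1 (hclose z hz.le)
      linarith [hR z (by linarith), hz'.2]
  have hlow : f x₀ + (h x₀ : EReal) < ((c₁ + δ : ℝ) : EReal) := by
    have hgx := (abs_le.1 (hclose x₀ (by linarith))).1
    cases hfx : f x₀ with
    | bot => exact absurd hfx (hbot x₀)
    | top => simp [hfx] at hc₁
    | coe r =>
      rw [hfx] at hc₁
      norm_cast at hc₁ ⊢
      linarith
  refine (hlow.trans (b := ((c₁ + δ : ℝ) : EReal)) (c := ((c₂ - δ : ℝ) : EReal)) ?_).trans_le
    (le_iInf₂ fun x hx => ?_)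
  · norm_cast
    linarith
  · have hgx := hc₂'.le.trans (iInf₂_le x hx)
    have hbx := hb x
    cases hfx : f x with
    | bot => exact absurd hfx (hbot x)
    | top => simp
    | coe r =>
      rw [hfx] at hgx hbx
      norm_cast at hgx hbx ⊢
      rcases le_total ‖x‖ ((N : ℝ) + 1) with hxN | hxN
      · linarith [(abs_le.1 (hclose x hxN)).2]
      · linarith [hfar x hxN, le_max_right (g 0 + 1) (c₂ - b)]
end
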